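/- arXiv:2006.01357 — 4 statements merged into one kernel-verified Lean document; each statement's English description precedes it below -/
import Mathlib

section
/- For h > 0, set D = 4 + h² and consider the midpoint-scheme coefficients a11 = a22 = (4 − h²)/D, a12 = 4·h/D, a21 = −4·h/D, b1 = 2·h/D, b2 = 4/D, and tr = a11 + a22. Define a = (a11·b1 + a12·b2 − b1)² + b1·(a11·b1 + a12·b2)·(2 − tr), b = (a21·b1 − a11·b2 + b2)² − b2·(a21·b1 − a11·b2)·(2 − tr), and c = (1/2)·(a21·b1 − a11·b2)·b1·tr + b1·b2·((1/2)·tr² − 1) − (a11·b1 + a12·b2)·(a21·b1 − a11·b2) − (1/2)·tr·(a11·b1 + a12·b2)·b2. Then a = b = 64·h²/(4 + h²)³, c = 0, and (4 − tr²)/(4·a) = 1 + h²/4. -/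
theorem stmt_12 (h D a11 a12 a21 a22 b1 b2 tr a b c : ℝ) (hh : 0 < h)
    (hD : D = 4 + h^2)
    (h11 : a11 = (4 - h^2)/D) (h22 : a22 = (4 - h^2)/D)
    (h12 : a12 = 4*h/D) (h21 : a21 = -(4*h)/D)
    (hb1 : b1 = 2*h/D) (hb2 : b2 = 4/D)
    (htr : tr = a11 + a22)
    (hadef : a = (a11*b1 + a12*b2 - b1)^2 + b1*(a11*b1 + a12*b2)*(2 - tr))
    (hbdef : b = (a21*b1 - a11*b2 + b2)^2 - b2*(a21*b1 - a11*b2)*(2 - tr))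
    (hcdef : c = (1/2)*(a21*b1 - a11*b2)*b1*tr + b1*b2*((1/2)*tr^2 - 1)
        - (a11*b1 + a12*b2)*(a21*b1 - a11*b2) - (1/2)*tr*(a11*b1 + a12*b2)*b2) :
    a = 64*h^2/(4 + h^2)^3 ∧ b = 64*h^2/(4 + h^2)^3 ∧ c = 0 ∧
      (4 - tr^2)/(4*a) = 1 + h^2/4 := by
  have hDpos : 0 < 4 + h^2 := by positivity
  have hne : 4 + h^2 ≠ 0 := hDpos.ne'
  have hh0 : h ≠ 0 := hh.ne'
  subst hD h11 h22 h12 h21 hb1 hb2 htr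
  have ha : a = 64*h^2/(4 + h^2)^3 := by
    rw [hadef]
    field_simp
    ring
  refine ⟨ha, ?_, ?_, ?_⟩
  · rw [hbdef]
    field_simp
    ring
  · rw [hcdef]
    field_simp
    ring
  · rw [ha]
    field_simp
    ring
end

section
/- For every real h, consider the exponential-Euler coefficients a11 = a22 = cos h, a12 = sin h, a21 = −sin h, b1 = sin h, b2 = cos h, and tr = a11 + a22 = 2·cos h. Define a = (a11·b1 + a12·b2 − b1)² + b1·(a11·b1 + a12·b2)·(2 − tr), b = (a21·b1 − a11·b2 + b2)² − b2·(a21·b1 − a11·b2)·(2 − tr), and c = (1/2)·(a21·b1 − a11·b2)·b1·tr + b1·b2·((1/2)·tr² − 1) − (a11·b1 + a12·b2)·(a21·b1 − a11·b2) − (1/2)·tr·(a11·b1 + a12·b2)·b2. Then a = sin²h, b = sin²h, and c = 0; in particular, when sin h ≠ 0, (4 − tr²)·(b·p² + a·q² + 2·c·p·q)/(4·(a·b − c²)) = p² + q² for all real p, q. -/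
theorem stmt_13 (h a11 a12 a21 a22 b1 b2 tr a b c : ℝ)
    (h11 : a11 = Real.cos h) (h22 : a22 = Real.cos h)
    (h12 : a12 = Real.sin h) (h21 : a21 = -Real.sin h)
    (hb1 : b1 = Real.sin h) (hb2 : b2 = Real.cos h)
    (htr : tr = a11 + a22)
    (hadef : a = (a11*b1 + a12*b2 - b1)^2 + b1*(a11*b1 + a12*b2)*(2 - tr))
    (hbdef : b = (a21*b1 - a11*b2 + b2)^2 - b2*(a21*b1 - a11*b2)*(2 - tr))
    (hcdef : c = (1/2)*(a21*b1 - a11*b2)*b1*tr + b1*b2*((1/2)*tr^2 - 1)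
        - (a11*b1 + a12*b2)*(a21*b1 - a11*b2) - (1/2)*tr*(a11*b1 + a12*b2)*b2) :
    a = Real.sin h ^ 2 ∧ b = Real.sin h ^ 2 ∧ c = 0 ∧
      (Real.sin h ≠ 0 → ∀ p q : ℝ,
        (4 - tr^2) * (b*p^2 + a*q^2 + 2*c*p*q) / (4*(a*b - c^2)) = p^2 + q^2) := by
  have hsc := Real.sin_sq_add_cos_sq h
  have hdet : a21 * b1 - a11 * b2 = -1 := by
    subst h21 hb1 h11 hb2
    linear_combination -hsc
  have htr' : tr = 2 * Real.cos h := by rw [htr, h11, h22]; ring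
  have ha : a = Real.sin h ^ 2 := by
    rw [hadef, htr', h11, h12, hb1, hb2]; ring
  have hb : b = Real.sin h ^ 2 := by
    rw [hbdef, hdet, htr', hb2]
    linear_combination -hsc
  have hc : c = 0 := by
    rw [hcdef, hdet, htr', h11, h12, hb1, hb2]; ring
  refine ⟨ha, hb, hc, fun hs p q => ?_⟩
  have hnum : 4 - tr ^ 2 = 4 * Real.sin h ^ 2 := by
    rw [htr']; linear_combination -4 * hsc
  rw [hnum, ha, hb, hc]
  field_simp
  ring
end

section
/- Let a11, a12, a21, a22, b1, b2 : ℝ → ℝ be functions such that, as h → 0⁺: a11(h) − 1 = O(h²), a22(h) − 1 = O(h²), a12(h) − h = O(h²), a21(h) + h = O(h²), b1(h) = O(h), b2(h) − 1 = O(h), and a11(h)·a22(h) − a12(h)·a21(h) = 1 for all sufficiently small h > 0. Set tr(h) = a11(h) + a22(h) and define a(h) = (a11(h)·b1(h) + a12(h)·b2(h) − b1(h))² + b1(h)·(a11(h)·b1(h) + a12(h)·b2(h))·(2 − tr(h)), b(h) = (a21(h)·b1(h) − a11(h)·b2(h) + b2(h))² − b2(h)·(a21(h)·b1(h) − a11(h)·b2(h))·(2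 − tr(h)), and c(h) = (1/2)·(a21(h)·b1(h) − a11(h)·b2(h))·b1(h)·tr(h) + b1(h)·b2(h)·((1/2)·tr(h)² − 1) − (a11(h)·b1(h) + a12(h)·b2(h))·(a21(h)·b1(h) − a11(h)·b2(h)) − (1/2)·tr(h)·(a11(h)·b1(h) + a12(h)·b2(h))·b2(h). Then, as h → 0⁺: 2 − tr(h) − h² = O(h³), a(h) − h² = O(h³), b(h) − h² = O(h³), and c(h) = O(h³). -/
open Filter Topology Asymptotics

theorem isBigO_pow_of_le {m n : ℕ} (hnm : n ≤ m) :
    (fun h : ℝ => h ^ m) =O[𝓝[>] (0 : ℝ)] fun h => h ^ n := by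
  refine IsBigO.of_bound 1 ?_
  filter_upwards [Ioo_mem_nhdsGT (zero_lt_one (α := ℝ))] with h hh
  simpa [abs_of_pos hh.1] using pow_le_pow_of_le_one hh.1.le hh.2.le hnm

theorem Asymptotics.IsBigO.mul_of_le_add {f g : ℝ → ℝ} {m n k : ℕ}
    (hf : f =O[𝓝[>] (0 : ℝ)] fun h => h ^ m) (hg : g =O[𝓝[>] (0 : ℝ)] fun h => h ^ n)
    (hk : k ≤ m + n) : (fun h => f h * g h) =O[𝓝[>] (0 : ℝ)] fun h => h ^ k := by
  have hfg := hf.mul hg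
  simp only [← pow_add] at hfg
  exact hfg.trans (isBigO_pow_of_le hk)

theorem stmt_15 (a11 a12 a21 a22 b1 b2 tr a b c : ℝ → ℝ)
    (h11 : (fun h => a11 h - 1) =O[𝓝[>] (0:ℝ)] fun h => h^2)
    (h22 : (fun h => a22 h - 1) =O[𝓝[>] (0:ℝ)] fun h => h^2)
    (h12 : (fun h => a12 h - h) =O[𝓝[>] (0:ℝ)] fun h => h^2)
    (h21 : (fun h => a21 h + h) =O[𝓝[>] (0:ℝ)] fun h => h^2)
    (hb1 : b1 =O[𝓝[>] (0:ℝ)] fun h => h)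
    (hb2 : (fun h => b2 h - 1) =O[𝓝[>] (0:ℝ)] fun h => h)
    (hsymp : ∀ᶠ h in 𝓝[>] (0:ℝ), a11 h * a22 h - a12 h * a21 h = 1)
    (htr : ∀ h, tr h = a11 h + a22 h)
    (hadef : ∀ h, a h = (a11 h * b1 h + a12 h * b2 h - b1 h)^2
        + b1 h * (a11 h * b1 h + a12 h * b2 h) * (2 - tr h))
    (hbdef : ∀ h, b h = (a21 h * b1 h - a11 h * b2 h + b2 h)^2
        - b2 h * (a21 h * b1 h - a11 h * b2 h) * (2 - tr h))
    (hcdef : ∀ h, c h = (1/2) * (a21 h * b1 h - a11 h * b2 h) * b1 h * tr h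
        + b1 h * b2 h * ((1/2) * (tr h)^2 - 1)
        - (a11 h * b1 h + a12 h * b2 h) * (a21 h * b1 h - a11 h * b2 h)
        - (1/2) * tr h * (a11 h * b1 h + a12 h * b2 h) * b2 h) :
    ((fun h => 2 - tr h - h^2) =O[𝓝[>] (0:ℝ)] fun h => h^3) ∧
    ((fun h => a h - h^2) =O[𝓝[>] (0:ℝ)] fun h => h^3) ∧
    ((fun h => b h - h^2) =O[𝓝[>] (0:ℝ)] fun h => h^3) ∧
    (c =O[𝓝[>] (0:ℝ)] fun h => h^3) := by
  have hid : (fun h : ℝ => h) =O[𝓝[>] (0 : ℝ)] fun h => h ^ 1 := by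
    simpa using isBigO_refl (fun h : ℝ => h) (𝓝[>] 0)
  have hb1' : b1 =O[𝓝[>] (0 : ℝ)] fun h => h ^ 1 := by simpa using hb1
  have hb2' : (fun h => b2 h - 1) =O[𝓝[>] (0 : ℝ)] fun h => h ^ 1 := by simpa using hb2
  have hone : (fun _ : ℝ => (1 : ℝ)) =O[𝓝[>] (0 : ℝ)] fun h => h ^ 0 := by
    simpa using isBigO_refl (fun _ : ℝ => (1 : ℝ)) (𝓝[>] 0)
  have hb2O : b2 =O[𝓝[>] (0 : ℝ)] fun h => h ^ 0 :=
    ((hb2'.trans (isBigO_pow_of_le zero_le_one)).add hone).congr_left fun h => by ring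
  have hb2p : (fun h => b2 h + 1) =O[𝓝[>] (0 : ℝ)] fun h => h ^ 0 := hb2O.add hone
  have h21O : a21 =O[𝓝[>] (0 : ℝ)] fun h => h ^ 1 :=
    ((h21.trans (isBigO_pow_of_le one_le_two)).sub hid).congr_left fun h => by ring
  have hτh : (fun h => 2 - tr h - h ^ 2) =O[𝓝[>] (0 : ℝ)] fun h => h ^ 3 := by
    refine ((((h11.mul_of_le_add h22 (k := 3) (by norm_num)).sub
      (hid.mul_of_le_add h21 (k := 3) (by norm_num))).add
      (hid.mul_of_le_add h12 (k := 3) (by norm_num))).sub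
      (h12.mul_of_le_add h21 (k := 3) (by norm_num))).congr' ?_ EventuallyEq.rfl
    filter_upwards [hsymp] with h hh
    rw [htr]
    linear_combination hh
  have hτ : (fun h => 2 - tr h) =O[𝓝[>] (0 : ℝ)] fun h => h ^ 2 :=
    ((hτh.trans (isBigO_pow_of_le (by norm_num))).add (isBigO_refl _ _)).congr_left
      fun h => by ring
  obtain ⟨U, hU⟩ : ∃ U : ℝ → ℝ, ∀ h, U h = a11 h * b1 h + a12 h * b2 h - b1 h :=
    ⟨_, fun _ => rfl⟩
  obtain ⟨V, hV⟩ : ∃ V : ℝ → ℝ, ∀ h, V h = a21 h * b1 h - a11 h * b2 h + b2 h :=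
    ⟨_, fun _ => rfl⟩
  have hUh : (fun h => U h - h) =O[𝓝[>] (0 : ℝ)] fun h => h ^ 2 :=
    (((h11.mul_of_le_add hb1' (k := 2) (by norm_num)).add
      (h12.mul_of_le_add hb2O (k := 2) (by norm_num))).add
      (hid.mul_of_le_add hb2' (k := 2) (by norm_num))).congr_left
      fun h => by rw [hU]; ring
  have hUO : U =O[𝓝[>] (0 : ℝ)] fun h => h ^ 1 :=
    ((hUh.trans (isBigO_pow_of_le one_le_two)).add hid).congr_left fun h => by ring
  have hUp : (fun h => U h + h) =O[𝓝[>] (0 : ℝ)] fun h => h ^ 1 := hUO.add hid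
  have hX : (fun h => U h + b1 h) =O[𝓝[>] (0 : ℝ)] fun h => h ^ 1 := hUO.add hb1'
  have hVO : V =O[𝓝[>] (0 : ℝ)] fun h => h ^ 2 :=
    ((h21O.mul_of_le_add hb1' (k := 2) (by norm_num)).sub
      (h11.mul_of_le_add hb2O (k := 2) (by norm_num))).congr_left fun h => by rw [hV]; ring
  have hY : (fun h => V h - b2 h) =O[𝓝[>] (0 : ℝ)] fun h => h ^ 0 :=
    (hVO.trans (isBigO_pow_of_le (by norm_num))).sub hb2O
  have hbb := hb1'.mul_of_le_add hb2O (k := 1) (by norm_num)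
  refine ⟨hτh, ?_, ?_, ?_⟩
  · refine ((hUh.mul_of_le_add hUp (k := 3) (by norm_num)).add
      ((hb1'.mul_of_le_add hX (k := 2) (by norm_num)).mul_of_le_add hτ
        (k := 3) (by norm_num))).congr_left fun h => ?_
    rw [hadef, hU]
    ring
  · refine ((((hVO.mul_of_le_add hVO (k := 3) (by norm_num)).sub
      ((hb2O.mul_of_le_add hVO (k := 2) (by norm_num)).mul_of_le_add hτ
        (k := 3) (by norm_num))).add
      ((hb2'.mul_of_le_add hb2p (k := 1) (by norm_num)).mul_of_le_add hτ
        (k := 3) (by norm_num))).add hτh).congr_left fun h => ?_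
    rw [hbdef, hV]
    ring
  · have hcorr := ((((hY.mul_of_le_add hb1' (k := 1) (by norm_num)).const_mul_left (-1 / 2)).sub
      (hbb.const_mul_left 2)).add
      ((hX.mul_of_le_add hb2O (k := 1) (by norm_num)).const_mul_left (1 / 2))).add
      ((hτ.mul_of_le_add hbb (k := 1) (by norm_num)).const_mul_left (1 / 2))
    refine ((hτ.mul_of_le_add hcorr (k := 3) (by norm_num)).sub
      (hUO.mul_of_le_add hVO (k := 3) (by norm_num))).congr_left fun h => ?_
    rw [hcdef, hU, hV]
    ring
end

section
/- Let a11, a12, a21, a22, b1, b2 : ℝ → ℝ be functions such that, as h → 0⁺: a11(h) − 1 = O(h²), a22(h) − 1 = O(h²), a12(h) − h = O(h²), a21(h) + h = O(h²), b1(h) = O(h), b2(h) − 1 = O(h), and a11(h)·a22(h) − a12(h)·a21(h) = 1 for all sufficiently small h > 0. Set tr(h) = a11(h) + a22(h) and define a(h) = (a11(h)·b1(h) + a12(h)·b2(h) − b1(h))² + b1(h)·(a11(h)·b1(h) + a12(h)·b2(h))·(2 − tr(h)), b(h) = (a21(h)·b1(h) − a11(h)·b2(h) + b2(h))² − b2(h)·(a21(h)·b1(h)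 − a11(h)·b2(h))·(2 − tr(h)), and c(h) = (1/2)·(a21(h)·b1(h) − a11(h)·b2(h))·b1(h)·tr(h) + b1(h)·b2(h)·((1/2)·tr(h)² − 1) − (a11(h)·b1(h) + a12(h)·b2(h))·(a21(h)·b1(h) − a11(h)·b2(h)) − (1/2)·tr(h)·(a11(h)·b1(h) + a12(h)·b2(h))·b2(h). Then for all fixed real numbers p and q, the per-mode modified rate coefficient (4 − tr(h)²)·(b(h)·p² + a(h)·q² + 2·c(h)·p·q)/(4·(a(h)·b(h) − c(h)²)) tends to p² + q² as h → 0⁺. -/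
open Filter Topology Asymptotics

/-- If `f = O(h ^ 2)` as `h → 0⁺`, then `f h / h → 0`. -/
lemma tendsto_div_nhdsGT_zero_of_isBigO_sq {f : ℝ → ℝ}
    (hf : f =O[𝓝[>] (0:ℝ)] fun h => h^2) :
    Tendsto (fun h => f h / h) (𝓝[>] (0:ℝ)) (𝓝 0) := by
  have hlo : (fun h : ℝ => h^2) =o[𝓝[>] (0:ℝ)] fun h => h := by
    simpa using (isLittleO_pow_pow (𝕜 := ℝ) (show 1 < 2 by norm_num)).mono nhdsWithin_le_nhds
  exact (hf.trans_isLittleO hlo).tendsto_div_nhds_zero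

theorem stmt_16 (a11 a12 a21 a22 b1 b2 tr a b c : ℝ → ℝ)
    (h11 : (fun h => a11 h - 1) =O[𝓝[>] (0:ℝ)] fun h => h^2)
    (h22 : (fun h => a22 h - 1) =O[𝓝[>] (0:ℝ)] fun h => h^2)
    (h12 : (fun h => a12 h - h) =O[𝓝[>] (0:ℝ)] fun h => h^2)
    (h21 : (fun h => a21 h + h) =O[𝓝[>] (0:ℝ)] fun h => h^2)
    (hb1 : b1 =O[𝓝[>] (0:ℝ)] fun h => h)
    (hb2 : (fun h => b2 h - 1) =O[𝓝[>] (0:ℝ)] fun h => h)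
    (hsymp : ∀ᶠ h in 𝓝[>] (0:ℝ), a11 h * a22 h - a12 h * a21 h = 1)
    (htr : ∀ h, tr h = a11 h + a22 h)
    (hadef : ∀ h, a h = (a11 h * b1 h + a12 h * b2 h - b1 h)^2
        + b1 h * (a11 h * b1 h + a12 h * b2 h) * (2 - tr h))
    (hbdef : ∀ h, b h = (a21 h * b1 h - a11 h * b2 h + b2 h)^2
        - b2 h * (a21 h * b1 h - a11 h * b2 h) * (2 - tr h))
    (hcdef : ∀ h, c h = (1/2) * (a21 h * b1 h - a11 h * b2 h) * b1 h * tr h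
        + b1 h * b2 h * ((1/2) * (tr h)^2 - 1)
        - (a11 h * b1 h + a12 h * b2 h) * (a21 h * b1 h - a11 h * b2 h)
        - (1/2) * tr h * (a11 h * b1 h + a12 h * b2 h) * b2 h) :
    ∀ p q : ℝ,
      Tendsto (fun h =>
          (4 - (tr h)^2) * (b h * p^2 + a h * q^2 + 2 * c h * p * q)
            / (4 * (a h * b h - (c h)^2)))
        (𝓝[>] (0:ℝ)) (𝓝 (p^2 + q^2)) := by
  intro p q
  have hpos : ∀ᶠ h in 𝓝[>] (0:ℝ), h ≠ 0 :=
    eventually_mem_nhdsWithin.mono fun h hh => ne_of_gt hh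
  have hid : Tendsto (fun h : ℝ => h) (𝓝[>] (0:ℝ)) (𝓝 0) := nhdsWithin_le_nhds
  have tx := tendsto_div_nhdsGT_zero_of_isBigO_sq h11
  have ty := tendsto_div_nhdsGT_zero_of_isBigO_sq h22
  have tm : Tendsto (fun h => a12 h / h) (𝓝[>] (0:ℝ)) (𝓝 1) := by
    have := (tendsto_div_nhdsGT_zero_of_isBigO_sq h12).add_const 1
    rw [zero_add] at this
    refine this.congr' (hpos.mono fun h hh => ?_)
    field_simp
    ring
  have tn : Tendsto (fun h => a21 h / h) (𝓝[>] (0:ℝ)) (𝓝 (-1)) := by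
    have := (tendsto_div_nhdsGT_zero_of_isBigO_sq h21).sub_const 1
    rw [zero_sub] at this
    refine this.congr' (hpos.mono fun h hh => ?_)
    field_simp
    ring
  have tb1 := hb1.trans_tendsto hid
  have tb2 : Tendsto b2 (𝓝[>] (0:ℝ)) (𝓝 1) := by
    simpa using (hb2.trans_tendsto hid).add_const 1
  -- All rescaled quantities are polynomials in six variables with known limits.
  let s : ℝ → ℝ → ℝ → ℝ → ℝ := fun x y m n => x * y - m * n
  let u : ℝ → ℝ → ℝ → ℝ → ℝ → ℝ := fun h x m β₁ β₂ => (1 + h * x) * β₁ + h * m * β₂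
  let v : ℝ → ℝ → ℝ → ℝ → ℝ → ℝ := fun h x n β₁ β₂ => h * n * β₁ - (1 + h * x) * β₂
  let A : ℝ → ℝ → ℝ → ℝ → ℝ → ℝ → ℝ → ℝ := fun h x y m n β₁ β₂ =>
    (x * β₁ + m * β₂)^2 + β₁ * u h x m β₁ β₂ * s x y m n
  let B : ℝ → ℝ → ℝ → ℝ → ℝ → ℝ → ℝ → ℝ := fun h x y m n β₁ β₂ =>
    (n * β₁ - x * β₂)^2 - β₂ * v h x n β₁ β₂ * s x y m n
  let C : ℝ → ℝ → ℝ → ℝ → ℝ → ℝ → ℝ → ℝ := fun h x y m n β₁ β₂ =>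
    -((n * β₁ - x * β₂) * (x * β₁ + m * β₂))
      + s x y m n * (u h x m β₁ β₂ * β₂ - v h x n β₁ β₂ * β₁
        - β₁ * β₂ * (4 + h * (x + y))) / 2
  let F : ℝ × ℝ × ℝ × ℝ × ℝ × ℝ × ℝ → ℝ := fun ⟨h, x, y, m, n, β₁, β₂⟩ =>
    s x y m n * (4 + h * (x + y))
      * (B h x y m n β₁ β₂ * p^2 + A h x y m n β₁ β₂ * q^2 + 2 * C h x y m n β₁ β₂ * p * q)
      / (4 * (A h x y m n β₁ β₂ * B h x y m n β₁ β₂ - (C h x y m n β₁ β₂)^2))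
  have hF : ContinuousAt F (0, 0, 0, 1, -1, 0, 1) := by
    refine ContinuousAt.div (by fun_prop) (by fun_prop) ?_
    norm_num [A, B, C, u, v, s]
  have hF0 : F (0, 0, 0, 1, -1, 0, 1) = p^2 + q^2 := by
    norm_num [F, A, B, C, u, v, s]
  rw [← hF0]
  refine (hF.tendsto.comp (hid.prodMk_nhds (tx.prodMk_nhds (ty.prodMk_nhds
    (tm.prodMk_nhds (tn.prodMk_nhds (tb1.prodMk_nhds tb2))))))).congr' ?_
  filter_upwards [hpos, hsymp] with h hh hdet
  obtain ⟨x, hx⟩ : ∃ x, x = (a11 h - 1) / h := ⟨_, rfl⟩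
  obtain ⟨y, hy⟩ : ∃ y, y = (a22 h - 1) / h := ⟨_, rfl⟩
  obtain ⟨m, hm⟩ : ∃ m, m = a12 h / h := ⟨_, rfl⟩
  obtain ⟨n, hn⟩ : ∃ n, n = a21 h / h := ⟨_, rfl⟩
  have e11 : a11 h = 1 + h * x := by rw [hx]; field_simp; ring
  have e22 : a22 h = 1 + h * y := by rw [hy]; field_simp; ring
  have e12 : a12 h = h * m := by rw [hm]; field_simp
  have e21 : a21 h = h * n := by rw [hn]; field_simp
  have es : h * (x + y) = -(h^2 * s x y m n) := by
    rw [e11, e22, e12, e21] at hdet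
    simp only [s]
    linear_combination hdet
  have etr : tr h = 2 + h * (x + y) := by rw [htr, e11, e22]; ring
  have eA : a h = h^2 * A h x y m n (b1 h) (b2 h) := by
    rw [hadef, etr, e11, e12]
    simp only [A, u]
    linear_combination (-(b1 h * ((1 + h * x) * b1 h + h * m * b2 h))) * es
  have eB : b h = h^2 * B h x y m n (b1 h) (b2 h) := by
    rw [hbdef, etr, e11, e21]
    simp only [B, v]
    linear_combination (b2 h * (h * n * b1 h - (1 + h * x) * b2 h)) * es
  have eC : c h = h^2 * C h x y m n (b1 h) (b2 h) := by
    rw [hcdef, etr, e11, e12, e21]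
    simp only [C, u, v]
    linear_combination (-(((1 + h * x) * b1 h + h * m * b2 h) * b2 h
      - (h * n * b1 h - (1 + h * x) * b2 h) * b1 h
      - b1 h * b2 h * (4 + h * (x + y))) / 2) * es
  have e4 : 4 - (tr h)^2 = h^2 * (s x y m n * (4 + h * (x + y))) := by
    rw [etr]
    linear_combination (-(4 + h * (x + y))) * es
  simp only [Function.comp_apply]
  rw [← hx, ← hy, ← hm, ← hn, e4, eA, eB, eC]
  simp only [F]
  rw [← mul_div_mul_left _ _ (pow_ne_zero 4 hh)]
  congr 1 <;> ring
end
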